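/- Let a and b be odd positive integers, c an even positive integer, and let l and m be non-negative integers with (l,m) ≠ (0,0). Then for all but finitely many primes p, the sum, over all tuples (m₀, m₁, …, m_{2l}) of non-negative integers with m₀ + m₁ + ⋯ + m_{2l} = m, of the truncated multiple zeta value Z_p({c}^{m₀}, a, {c}^{m₁}, b, {c}^{m₂}, …, {c}^{m_{2l-2}}, a, {c}^{m_{2l-1}}, b, {c}^{m_{2l}}) has p-adic valuation at least 1 (i.e., the sum is congruent to 0 modulo p). -/

import Mathlib

/-- `ZAux N ks a = ∑_{a ≤ n₁ < ⋯ < n_r ≤ N} ∏ᵢ 1/nᵢ^{kᵢ}` for `ks = (k₁,…,k_r)`. -/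
def ZAux (N : ℕ) : List ℕ → ℕ → ℚ
  | [], _ => 1
  | k :: ks, a => ∑ n ∈ Finset.Icc a N, ((n : ℚ) ^ k)⁻¹ * ZAux N ks (n + 1)

/-- Truncated multiple zeta value `Z_p(k₁,…,k_r) = ∑_{1 ≤ n₁ < ⋯ < n_r ≤ p-1} 1/(n₁^{k₁}⋯n_r^{k_r})`. -/
def Z (p : ℕ) (ks : List ℕ) : ℚ := ZAux (p - 1) ks 1

/-- `ZsAux N ks a = ∑_{a ≤ n₁ ≤ ⋯ ≤ n_r ≤ N} ∏ᵢ 1/nᵢ^{kᵢ}`. -/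
def ZsAux (N : ℕ) : List ℕ → ℕ → ℚ
  | [], _ => 1
  | k :: ks, a => ∑ n ∈ Finset.Icc a N, ((n : ℚ) ^ k)⁻¹ * ZsAux N ks n

/-- Truncated multiple zeta-star value. -/
def Zstar (p : ℕ) (ks : List ℕ) : ℚ := ZsAux (p - 1) ks 1

/-- `α ≡ β (mod p^e)` for rationals: the `p`-adic valuation of `α - β` is at least `e`,
expressed via the `p`-adic norm. -/
def congrMod (p e : ℕ) (α β : ℚ) : Prop := padicNorm p (α - β) ≤ (p : ℚ) ^ (-(e : ℤ))

/-- `gapIndex a b c [m₀, m₁, …, m_{2l}]` is the index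
`{c}^{m₀}, a, {c}^{m₁}, b, {c}^{m₂}, …, a, {c}^{m_{2l-1}}, b, {c}^{m_{2l}}`. -/
def gapIndex (a b c : ℕ) : List ℕ → List ℕ
  | [] => []
  | [m0] => List.replicate m0 c
  | m0 :: m1 :: rest =>
      List.replicate m0 c ++ a :: (List.replicate m1 c ++ b :: gapIndex a b c rest)

/-- `powerSum v N ks n₀ = ∑_{n₀ ≤ n₁ < ⋯ < n_r ≤ N} ∏ᵢ (v nᵢ)^{kᵢ}`. -/
def powerSum {R : Type*} [CommSemiring R] (v : ℕ → R) (N : ℕ) : List ℕ → ℕ → R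
  | [], _ => 1
  | k :: ks, n₀ => ∑ n ∈ Finset.Icc n₀ N, v n ^ k * powerSum v N ks (n + 1)

/-- Sum of `G` over all ways of prepending `{c}^i, k` to a word, `i` being taken out of the
number `m` of available entries `c`. -/
def gapSum {R : Type*} [CommSemiring R] (c k : ℕ) (G : ℕ → (List ℕ → R) → R) (m : ℕ)
    (φ : List ℕ → R) : R :=
  ∑ ij ∈ Finset.HasAntidiagonal.antidiagonal m, G ij.2 fun w => φ (List.replicate ij.1 c ++ k :: w)

/-- Sum of `φ` over all words with `m` entries `c` inserted into `{a, b}^l`. -/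
def pairSum {R : Type*} [CommSemiring R] (a b c : ℕ) : ℕ → ℕ → (List ℕ → R) → R
  | 0 => fun m φ => φ (List.replicate m c)
  | l + 1 => gapSum c a (gapSum c b (pairSum a b c l))

section PowerSum

variable {R : Type*} [CommSemiring R]

theorem powerSum_cons_of_le (v : ℕ → R) {N n : ℕ} (hn : n ≤ N) (k : ℕ) (ks : List ℕ) :
    powerSum v N (k :: ks) n =
      v n ^ k * powerSum v N ks (n + 1) + powerSum v N (k :: ks) (n + 1) := by
  simp only [powerSum]
  rw [← Finset.insert_Icc_add_one_left_eq_Icc hn, Finset.sum_insert (by simp)]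

theorem powerSum_cons_of_lt (v : ℕ → R) {N n : ℕ} (hn : N < n) (k : ℕ) (ks : List ℕ) :
    powerSum v N (k :: ks) n = 0 := by
  simp [powerSum, Finset.Icc_eq_empty_of_lt hn]

theorem map_powerSum {S : Type*} [CommSemiring S] (f : R →+* S) {v : ℕ → R} {w : ℕ → S} {N : ℕ}
    (h : ∀ n ∈ Finset.Icc 1 N, f (v n) = w n) (ks : List ℕ) {n₀ : ℕ} (hn : 1 ≤ n₀) :
    f (powerSum v N ks n₀) = powerSum w N ks n₀ := by
  induction ks generalizing n₀ with
  | nil => simp [powerSum]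
  | cons k ks ih =>
    simp only [powerSum, map_sum, map_mul, map_pow]
    refine Finset.sum_congr rfl fun n hn' => ?_
    rw [Finset.mem_Icc] at hn'
    rw [ih (by omega), h n (Finset.mem_Icc.2 (by omega))]

end PowerSum

theorem ZAux_eq_powerSum (N : ℕ) (ks : List ℕ) (n₀ : ℕ) :
    ZAux N ks n₀ = powerSum (fun n => (n : ℚ)⁻¹) N ks n₀ := by
  induction ks generalizing n₀ with
  | nil => rfl
  | cons k ks ih => simp [ZAux, powerSum, ih]

section GapSum

variable {R : Type*} [CommSemiring R]

theorem gapSum_zero (c k : ℕ) (G : ℕ → (List ℕ → R) → R) (φ : List ℕ → R) :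
    gapSum c k G 0 φ = G 0 fun w => φ (k :: w) := by
  simp [gapSum]

theorem gapSum_succ (c k : ℕ) (G : ℕ → (List ℕ → R) → R) (m : ℕ) (φ : List ℕ → R) :
    gapSum c k G (m + 1) φ =
      G (m + 1) (fun w => φ (k :: w)) + gapSum c k G m fun w => φ (c :: w) := by
  simp [gapSum, Finset.Nat.sum_antidiagonal_succ, List.replicate_succ]

theorem gapSum_linear {c k : ℕ} {G : ℕ → (List ℕ → R) → R}
    (hG : ∀ m x φ ψ, G m (fun w => x * φ w + ψ w) = x * G m φ + G m ψ)
    (m : ℕ) (x : R) (φ ψ : List ℕ → R) :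
    gapSum c k G m (fun w => x * φ w + ψ w) = x * gapSum c k G m φ + gapSum c k G m ψ := by
  simp [gapSum, hG, Finset.sum_add_distrib, Finset.mul_sum]

theorem pairSum_linear (a b c l m : ℕ) (x : R) (φ ψ : List ℕ → R) :
    pairSum a b c l m (fun w => x * φ w + ψ w) =
      x * pairSum a b c l m φ + pairSum a b c l m ψ := by
  induction l generalizing m x φ ψ with
  | zero => rfl
  | succ l ih => exact gapSum_linear (gapSum_linear ih) m x φ ψ

theorem gapSum_powerSum_zero {c k : ℕ} {G : ℕ → (List ℕ → R) → R}
    (hG : ∀ m x φ ψ, G m (fun w => x * φ w + ψ w) = x * G m φ + G m ψ)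
    (v : ℕ → R) {N n : ℕ} (hn : n ≤ N) :
    gapSum c k G 0 (powerSum v N · n) =
      v n ^ k * G 0 (powerSum v N · (n + 1)) + gapSum c k G 0 (powerSum v N · (n + 1)) := by
  simp only [gapSum_zero, powerSum_cons_of_le v hn, hG]

theorem gapSum_powerSum_succ {c k : ℕ} {G : ℕ → (List ℕ → R) → R}
    (hG : ∀ m x φ ψ, G m (fun w => x * φ w + ψ w) = x * G m φ + G m ψ)
    (v : ℕ → R) {N n : ℕ} (hn : n ≤ N) (m : ℕ) :
    gapSum c k G (m + 1) (powerSum v N · n) =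
      v n ^ k * G (m + 1) (powerSum v N · (n + 1)) +
        v n ^ c * gapSum c k G m (powerSum v N · (n + 1)) +
        gapSum c k G (m + 1) (powerSum v N · (n + 1)) := by
  simp only [gapSum_succ, powerSum_cons_of_le v hn, hG, gapSum_linear hG]
  ring

theorem gapSum_eq_zero {R : Type*} [CommRing R] {c k : ℕ} {G : ℕ → (List ℕ → R) → R}
    (hG : ∀ m x φ ψ, G m (fun w => x * φ w + ψ w) = x * G m φ + G m ψ)
    (m : ℕ) {φ : List ℕ → R} (hφ : ∀ k ks, φ (k :: ks) = 0) : gapSum c k G m φ = 0 := by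
  refine Finset.sum_eq_zero fun ij _ => ?_
  have h (w : List ℕ) : φ (List.replicate ij.1 c ++ k :: w) = 0 := by
    cases ij.1 <;> simp [List.replicate_succ, hφ]
  simpa [h] using hG ij.2 (-1) (fun _ => 0) fun _ => 0

end GapSum

theorem sum_antidiagonalTuple_succ {M : Type*} [AddCommMonoid M] (k n : ℕ)
    (φ : (Fin (k + 1) → ℕ) → M) :
    ∑ f ∈ Finset.Nat.antidiagonalTuple (k + 1) n, φ f =
      ∑ ij ∈ Finset.HasAntidiagonal.antidiagonal n, ∑ f ∈ Finset.Nat.antidiagonalTuple k ij.2,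
        φ (Fin.cons ij.1 f) := by
  rw [Finset.sum_sigma']
  refine Finset.sum_bij' (fun f _ => ⟨(f 0, ∑ i, Fin.tail f i), Fin.tail f⟩)
    (fun x _ => Fin.cons x.1.1 x.2) ?_ ?_ ?_ ?_ ?_
  · intro f hf
    simpa [Finset.Nat.mem_antidiagonalTuple, Fin.sum_univ_succ, Fin.tail] using hf
  · rintro ⟨⟨i, j⟩, f⟩ hf
    simp only [Finset.mem_sigma, Finset.HasAntidiagonal.mem_antidiagonal,
      Finset.Nat.mem_antidiagonalTuple] at hf
    simp [Finset.Nat.mem_antidiagonalTuple, Fin.sum_univ_succ, hf.1, hf.2]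
  · intro f _
    simp
  · rintro ⟨⟨i, j⟩, f⟩ hf
    simp only [Finset.mem_sigma, Finset.HasAntidiagonal.mem_antidiagonal,
      Finset.Nat.mem_antidiagonalTuple] at hf
    simp [hf.2]
  · intro f _
    simp

theorem sum_gapIndex {R : Type*} [CommSemiring R] (a b c l m : ℕ) (φ : List ℕ → R) :
    ∑ f ∈ Finset.Nat.antidiagonalTuple (2 * l + 1) m, φ (gapIndex a b c (List.ofFn f)) =
      pairSum a b c l m φ := by
  induction l generalizing m φ with
  | zero => simp [pairSum, gapIndex]
  | succ l ih =>
    rw [show 2 * (l + 1) + 1 = 2 * l + 1 + 1 + 1 by ring, sum_antidiagonalTuple_succ]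
    refine Finset.sum_congr rfl fun ij _ => ?_
    rw [sum_antidiagonalTuple_succ]
    refine Finset.sum_congr rfl fun rs _ => ?_
    rw [← ih]
    refine Finset.sum_congr rfl fun f _ => ?_
    rw [List.ofFn_cons, List.ofFn_cons]
    rfl

section GeneratingSeries

open PowerSeries Matrix

variable {R : Type*} [CommRing R]

/-- The matrix attached to the summation variable `n`, written in terms of `x = 1/n`: the outer
power series variable counts pairs `(a, b)`, the inner one counts entries `c`. -/
noncomputable def stepMatrix (a b c : ℕ) (x : R) :
    Matrix (Fin 2) (Fin 2) (PowerSeries (PowerSeries R)) :=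
  !![1 + C (C (x ^ c) * X), X * C (C (x ^ a)); C (C (x ^ b)), 1 + C (C (x ^ c) * X)]

/-- The pair of generating series of `pairSum` (the first odd entry is `a`) and of its analogue
for words in which the first odd entry is `b`. -/
noncomputable def genVec (a b c : ℕ) (v : ℕ → R) (N n : ℕ) : Fin 2 → PowerSeries (PowerSeries R) :=
  ![.mk fun l => .mk fun m => pairSum a b c l m (powerSum v N · n),
    .mk fun l => .mk fun m => gapSum c b (pairSum a b c l) m (powerSum v N · n)]

theorem stepMatrix_mulVec (a b c : ℕ) (x : R) (f g : PowerSeries (PowerSeries R)) :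
    stepMatrix a b c x *ᵥ ![f, g] =
      ![(1 + C (C (x ^ c) * X)) * f + X * (C (C (x ^ a)) * g),
        C (C (x ^ b)) * f + (1 + C (C (x ^ c) * X)) * g] := by
  ext i : 1
  fin_cases i <;> simp [stepMatrix, mulVec, dotProduct, mul_assoc]

theorem coeff_zero_one_add_mul (x : R) (f : PowerSeries (PowerSeries R)) (l : ℕ) :
    coeff 0 (coeff l ((1 + C (C x * X)) * f)) = coeff 0 (coeff l f) := by
  simp [add_mul, coeff_C_mul, mul_assoc]

theorem coeff_succ_one_add_mul (x : R) (f : PowerSeries (PowerSeries R)) (l m : ℕ) :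
    coeff (m + 1) (coeff l ((1 + C (C x * X)) * f)) =
      coeff (m + 1) (coeff l f) + x * coeff m (coeff l f) := by
  rw [add_mul, one_mul, map_add, coeff_C_mul, mul_assoc, map_add, coeff_C_mul, coeff_succ_X_mul]

theorem genVec_of_le (a b c : ℕ) (v : ℕ → R) {N n : ℕ} (hn : n ≤ N) :
    genVec a b c v N n = stepMatrix a b c (v n) *ᵥ genVec a b c v N (n + 1) := by
  have key := fun l => pairSum_linear (R := R) a b c l
  rw [genVec, genVec, stepMatrix_mulVec]
  ext i l m
  fin_cases i
  · simp only [Fin.zero_eta, cons_val_zero, map_add]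
    rcases m with _ | m
    · rw [coeff_zero_one_add_mul]
      rcases l with _ | l
      · simp [pairSum, powerSum]
      · simp only [coeff_succ_X_mul, coeff_C_mul, coeff_mk, pairSum,
          gapSum_powerSum_zero (gapSum_linear (key l)) v hn]
        ring
    · rw [coeff_succ_one_add_mul]
      rcases l with _ | l
      · simp [pairSum, List.replicate_succ, powerSum_cons_of_le v hn, add_comm]
      · simp only [coeff_succ_X_mul, coeff_C_mul, coeff_mk, pairSum,
          gapSum_powerSum_succ (gapSum_linear (key l)) v hn]
        ring
  · simp only [Fin.mk_one, cons_val_one, cons_val_fin_one, map_add]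
    rcases m with _ | m
    · simp only [coeff_zero_one_add_mul, coeff_C_mul, coeff_mk, gapSum_powerSum_zero (key l) v hn]
    · simp only [coeff_succ_one_add_mul, coeff_C_mul, coeff_mk, gapSum_powerSum_succ (key l) v hn]
      ring

theorem genVec_of_lt (a b c : ℕ) (v : ℕ → R) {N n : ℕ} (hn : N < n) :
    genVec a b c v N n = ![1, 0] := by
  have hφ := powerSum_cons_of_lt v hn
  ext i l m
  fin_cases i
  · rcases l with _ | l
    · rcases m with _ | m <;> simp [genVec, pairSum, List.replicate_succ, hφ, powerSum, coeff_one,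
        -coeff_zero_eq_constantCoeff]
    · simpa [genVec, pairSum, coeff_one] using
        gapSum_eq_zero (gapSum_linear (pairSum_linear a b c l)) m hφ
  · simpa [genVec] using gapSum_eq_zero (pairSum_linear a b c l) m hφ

/-- The ordered product of `M k, …, M (k + n - 1)`. -/
def orderedProd {S : Type*} [Monoid S] (M : ℕ → S) (k : ℕ) : ℕ → S
  | 0 => 1
  | n + 1 => orderedProd M k n * M (k + n)

theorem orderedProd_succ' {S : Type*} [Monoid S] (M : ℕ → S) (k n : ℕ) :
    orderedProd M k (n + 1) = M k * orderedProd M (k + 1) n := by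
  induction n with
  | zero => simp [orderedProd]
  | succ n ih =>
    rw [orderedProd, ih, orderedProd, mul_assoc, add_right_comm, add_assoc k]

theorem det_orderedProd {S ι : Type*} [CommRing S] [Fintype ι] [DecidableEq ι]
    (M : ℕ → Matrix ι ι S) (k n : ℕ) :
    (orderedProd M k n).det = ∏ i ∈ Finset.range n, (M (k + i)).det := by
  induction n with
  | zero => simp [orderedProd]
  | succ n ih => rw [orderedProd, det_mul, ih, Finset.prod_range_succ]

theorem genVec_eq_orderedProd_mulVec (a b c : ℕ) (v : ℕ → R) (n k : ℕ) :
    genVec a b c v (k + n) (k + 1) =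
      orderedProd (fun i => stepMatrix a b c (v i)) (k + 1) n *ᵥ ![1, 0] := by
  induction n generalizing k with
  | zero => simp [orderedProd, genVec_of_lt]
  | succ n ih =>
    rw [genVec_of_le _ _ _ _ (by omega), orderedProd_succ', ← mulVec_mulVec, ← ih,
      show k + (n + 1) = k + 1 + n by ring]

theorem stepMatrix_neg {a b c : ℕ} (ha : Odd a) (hb : Odd b) (hc : Even c) (x : R) :
    stepMatrix a b c (-x) = (stepMatrix a b c x).adjugate := by
  simp [stepMatrix, ha.neg_pow, hb.neg_pow, hc.neg_pow, adjugate_fin_two_of]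

theorem det_stepMatrix (a b c : ℕ) (x : R) :
    (stepMatrix a b c x).det =
      (1 + C (C (x ^ c) * X)) ^ 2 - X * C (C (x ^ (a + b))) := by
  simp [stepMatrix, det_fin_two_of, pow_add]
  ring

theorem orderedProd_eq_smul_one {S : Type*} [CommRing S] {M : ℕ → Matrix (Fin 2) (Fin 2) S}
    {h : ℕ} (hM : ∀ n ≤ h, 1 ≤ n → M (2 * h + 1 - n) = (M n).adjugate) {j : ℕ} (hj : j ≤ h) :
    ∃ d : S, orderedProd M (h + 1 - j) (2 * j) = d • 1 := by
  induction j with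
  | zero => exact ⟨1, by simp [orderedProd]⟩
  | succ j ih =>
    obtain ⟨d, hd⟩ := ih (by omega)
    refine ⟨d * (M (h - j)).det, ?_⟩
    rw [show 2 * (j + 1) = 2 * j + 1 + 1 by ring, orderedProd_succ', orderedProd,
      show h + 1 - (j + 1) + 1 = h + 1 - j by omega, hd,
      show h + 1 - j + 2 * j = 2 * h + 1 - (h - j) by omega, hM _ (by omega) (by omega),
      show h + 1 - (j + 1) = h - j by omega, smul_mul_assoc, one_mul,
      mul_smul_comm, mul_adjugate, smul_smul]

end GeneratingSeries

section FiniteField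

open PowerSeries

variable {F : Type*} [Field F]

/-- The automorphism of `F⟦t⟧⟦u⟧` scaling `t` by `x` and `u` by `y`. -/
noncomputable def biScale (x y : F) : PowerSeries (PowerSeries F) →+* PowerSeries (PowerSeries F) :=
  (rescale (C y)).comp (PowerSeries.map (rescale x))

theorem coeff_coeff_biScale (x y : F) (f : PowerSeries (PowerSeries F)) (l m : ℕ) :
    coeff m (coeff l (biScale x y f)) = y ^ l * (x ^ m * coeff m (coeff l f)) := by
  simp [biScale, coeff_rescale, ← map_pow]

theorem rescale_C_eq_self {S : Type*} [CommSemiring S] (x y : S) : rescale x (C y) = C y := by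
  ext n
  rcases n with _ | n <;> simp [coeff_rescale, coeff_C]

theorem biScale_det_stepMatrix (a b c : ℕ) (x g : F) :
    biScale (g ^ c) (g ^ (a + b)) (stepMatrix a b c x).det = (stepMatrix a b c (x * g)).det := by
  simp only [det_stepMatrix, biScale, RingHom.comp_apply, map_sub, map_add, map_mul, map_pow,
    map_one, map_X, map_C, rescale_X, rescale_C_eq_self, mul_pow]
  ring

theorem det_stepMatrix_zero {a b c : ℕ} (ha : 0 < a) (hc : 0 < c) :
    (stepMatrix a b c (0 : F)).det = 1 := by
  simp [det_stepMatrix, ha.ne', hc.ne']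

theorem biScale_eq_self {a b c : ℕ} [Fintype F] (h2 : (2 : F) ≠ 0)
    {f : PowerSeries (PowerSeries F)}
    (hf : f ^ 2 = ∏ x : F, (stepMatrix a b c x).det) (h1 : coeff 0 (coeff 0 f) = 1)
    {g : F} (hg : g ≠ 0) : biScale (g ^ c) (g ^ (a + b)) f = f := by
  have hsq : biScale (g ^ c) (g ^ (a + b)) f ^ 2 = f ^ 2 := by
    rw [← map_pow, hf, map_prod]
    simp only [biScale_det_stepMatrix]
    exact Equiv.prod_comp (Equiv.mulRight₀ g hg) fun x => (stepMatrix a b c x).det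
  refine (sq_eq_sq_iff_eq_or_eq_neg.1 hsq).resolve_right fun h => h2 ?_
  have h0 := congrArg (fun f => coeff 0 (coeff 0 f)) h
  simp only [coeff_coeff_biScale, pow_zero, one_mul, map_neg, h1] at h0
  linear_combination h0

theorem coeff_coeff_eq_zero {a b c : ℕ} [Fintype F] (h2 : (2 : F) ≠ 0)
    {f : PowerSeries (PowerSeries F)}
    (hf : f ^ 2 = ∏ x : F, (stepMatrix a b c x).det) (h1 : coeff 0 (coeff 0 f) = 1)
    {l m : ℕ} (hw : ¬ Fintype.card F - 1 ∣ (a + b) * l + c * m) : coeff m (coeff l f) = 0 := by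
  rw [← FiniteField.forall_pow_eq_one_iff, not_forall] at hw
  obtain ⟨g, hg⟩ := hw
  have h := congrArg (fun f => coeff m (coeff l f)) (biScale_eq_self h2 hf h1 g.ne_zero)
  simp only [coeff_coeff_biScale, ← pow_mul, ← mul_assoc, ← pow_add] at h
  by_contra h0
  exact hg (Units.ext (by simpa [h0] using h))

end FiniteField

section ZMod

open PowerSeries Matrix

variable {p : ℕ} [Fact p.Prime]

theorem prod_range_inv_zmod {M : Type*} [CommMonoid M] {D : ZMod p → M} (hD : D 0 = 1) :
    ∏ i ∈ Finset.range (p - 1), D ((0 + 1 + i : ℕ) : ZMod p)⁻¹ = ∏ x : ZMod p, D x := by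
  have hp : p - 1 + 1 = p := Nat.sub_add_cancel (Fact.out (p := p.Prime)).one_le
  calc _ = ∏ i ∈ Finset.range (p - 1 + 1), D ((i : ℕ) : ZMod p)⁻¹ := by
        rw [Finset.prod_range_succ']
        simp [hD, add_comm]
    _ = ∏ i : ZMod p, D i⁻¹ := by
        rw [hp]
        refine Finset.prod_bij' (fun i _ => (i : ZMod p)) (fun x _ => x.val) ?_ ?_ ?_ ?_ ?_
        · simp
        · simp [ZMod.val_lt]
        · intro i hi
          exact ZMod.val_cast_of_lt (Finset.mem_range.1 hi)
        · simp
        · simp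
    _ = _ := Equiv.prod_comp (Equiv.inv (ZMod p)) D

theorem pairSum_powerSum_zmod_eq_zero {a b c : ℕ} (ha : Odd a) (hb : Odd b) (hc : Even c)
    (hc0 : 0 < c) (hp2 : p ≠ 2) {l m : ℕ} (hw : ¬ p - 1 ∣ (a + b) * l + c * m) :
    pairSum a b c l m (powerSum (fun n => (n : ZMod p)⁻¹) (p - 1) · 1) = 0 := by
  have hp : p.Prime := Fact.out
  obtain ⟨h, hh⟩ := hp.odd_of_ne_two hp2
  set v : ℕ → ZMod p := fun n => (n : ZMod p)⁻¹ with hv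
  have hM (n : ℕ) (hn : n ≤ h) (_ : 1 ≤ n) : stepMatrix a b c (v (2 * h + 1 - n)) =
      (stepMatrix a b c (v n)).adjugate := by
    rw [← stepMatrix_neg ha hb hc, ← hh]
    simp [hv, Nat.cast_sub (show n ≤ p by omega), inv_neg]
  obtain ⟨d, hd⟩ := orderedProd_eq_smul_one (M := fun i => stepMatrix a b c (v i)) hM le_rfl
  have hgen := genVec_eq_orderedProd_mulVec a b c v (p - 1) 0
  rw [zero_add, zero_add, show p - 1 = 2 * h by omega] at hgen
  rw [show h + 1 - h = 1 by omega] at hd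
  rw [hd, smul_mulVec, one_mulVec] at hgen
  have hd' : PowerSeries.mk (fun l => .mk fun m => pairSum a b c l m (powerSum v (p - 1) · 1))
      = d := by
    simpa [genVec, hh] using congrFun hgen 0
  have hsq : d ^ 2 = ∏ x : ZMod p, (stepMatrix a b c x).det := by
    rw [← prod_range_inv_zmod (D := fun x => (stepMatrix a b c x).det)
      (det_stepMatrix_zero ha.pos hc0)]
    have hdet := det_orderedProd (fun i => stepMatrix a b c (v i)) 1 (2 * h)
    rw [hd, det_smul, det_one, mul_one, Fintype.card_fin] at hdet
    rw [hdet, zero_add, show p - 1 = 2 * h by omega]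
  have h0 : coeff 0 (coeff 0 d) = 1 := by
    rw [← hd', coeff_mk, coeff_mk]
    simp [pairSum, powerSum]
  have := coeff_coeff_eq_zero (l := l) (m := m) (Ring.two_ne_zero (by rwa [ZMod.ringChar_zmod_n]))
    hsq h0 (by rwa [ZMod.card])
  rwa [← hd', coeff_mk, coeff_mk] at this

theorem congrMod_one_of_toZMod_eq_zero {α : ℚ} {x : ℤ_[p]}
    (hx : PadicInt.Coe.ringHom x = (α : ℚ_[p]))
    (h : PadicInt.toZMod x = 0) : congrMod p 1 α 0 := by
  have hx' : x ∈ RingHom.ker (PadicInt.toZMod (p := p)) := h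
  rw [PadicInt.ker_toZMod, PadicInt.maximalIdeal_eq_span_p, ← pow_one (p : ℤ_[p]),
    ← PadicInt.norm_le_pow_iff_mem_span_pow, PadicInt.norm_def] at hx'
  change ‖PadicInt.Coe.ringHom x‖ ≤ _ at hx'
  rw [hx, Padic.eq_padicNorm] at hx'
  rw [congrMod, sub_zero, ← Rat.cast_le (K := ℝ)]
  simpa using hx'

theorem isUnit_natCast_padicInt {n : ℕ} (hn : n ∈ Finset.Icc 1 (p - 1)) :
    IsUnit (n : ℤ_[p]) := by
  rw [Finset.mem_Icc] at hn
  rw [PadicInt.isUnit_iff, PadicInt.norm_natCast_eq_one_iff]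
  exact (Nat.coprime_of_lt_prime (by omega : n ≠ 0) (by omega : n < p) Fact.out)

theorem map_ringInverse_natCast {K : Type*} [Field K] (f : ℤ_[p] →+* K) {n : ℕ}
    (hn : n ∈ Finset.Icc 1 (p - 1)) : f (Ring.inverse (n : ℤ_[p])) = (n : K)⁻¹ := by
  refine eq_inv_of_mul_eq_one_left ?_
  rw [← map_natCast f, ← map_mul, Ring.inverse_mul_cancel _ (isUnit_natCast_padicInt hn), map_one]

end ZMod

/-- Saito–Wakabayashi: the Bowman–Bradley type sum of finite multiple zeta values in 𝒜₁ vanishes. -/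
theorem stmt2 (a b c : ℕ) (ha : Odd a) (ha0 : 0 < a) (hb : Odd b) (hb0 : 0 < b)
    (hc : Even c) (hc0 : 0 < c) (l m : ℕ) (h : (l, m) ≠ (0, 0)) :
    ∀ᶠ p in Filter.cofinite, p.Prime →
      congrMod p 1
        (∑ f ∈ Finset.Nat.antidiagonalTuple (2 * l + 1) m,
          Z p (gapIndex a b c (List.ofFn f)))
        0 := by
  have hw : 0 < (a + b) * l + c * m := by
    rcases Nat.eq_zero_or_pos l with rfl | hl
    · have hm : 0 < m := Nat.pos_of_ne_zero fun hm => h (by rw [hm])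
      positivity
    · positivity
  refine (Set.finite_Iic ((a + b) * l + c * m + 2)).subset fun p hp => ?_
  by_contra hlt
  refine hp fun hprime => ?_
  have : Fact p.Prime := ⟨hprime⟩
  rw [Set.mem_Iic, not_le] at hlt
  let w : ℕ → ℤ_[p] := fun n => Ring.inverse (n : ℤ_[p])
  refine congrMod_one_of_toZMod_eq_zero (x := ∑ f ∈ Finset.Nat.antidiagonalTuple (2 * l + 1) m,
    powerSum w (p - 1) (gapIndex a b c (List.ofFn f)) 1) ?_ ?_
  · rw [map_sum, Rat.cast_sum]
    refine Finset.sum_congr rfl fun f _ => ?_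
    rw [Z, ZAux_eq_powerSum,
      map_powerSum _ (fun n hn => map_ringInverse_natCast PadicInt.Coe.ringHom hn) _ le_rfl,
      ← Rat.coe_castHom, map_powerSum (Rat.castHom ℚ_[p]) (w := fun n => (n : ℚ_[p])⁻¹)
        (fun n _ => by simp) _ le_rfl]
  · rw [map_sum, Finset.sum_congr rfl fun f _ => map_powerSum _
      (fun n hn => map_ringInverse_natCast PadicInt.toZMod hn) _ le_rfl,
      sum_gapIndex a b c l m (powerSum (fun n => (n : ZMod p)⁻¹) (p - 1) · 1)]
    exact pairSum_powerSum_zmod_eq_zero ha hb hc hc0 (by omega)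
      fun hdvd => by have := Nat.le_of_dvd hw hdvd; omega
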